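/- Let n, m be coprime positive integers. The set X × mℤ is a union of ≈-equivalence classes, and the map sending the ≈-equivalence class of a pair (λ, mℓ) ∈ X × mℤ to its ∼-equivalence class [λ, mℓ] is a well-defined bijection from the set of ≈-equivalence classes contained in X × mℤ onto the set of ∼-equivalence classes of X × ℤ. -/

import Mathlib

/-- A Young diagram in the `n × m` rectangle, recorded as its sequence of parts
`λ_1 ≥ λ_2 ≥ … ≥ λ_n` (indexed from `1`), with `λ_i = 0` for `i = 0` and `i > n`. -/
structure YD (n m : ℕ) where
  part : ℕ → ℕ
  mono : ∀ ⦃i j : ℕ⦄, 1 ≤ i → i ≤ j → part j ≤ part i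
  le_m : part 1 ≤ m
  outside : ∀ i, n < i → part i = 0
  at_zero : part 0 = 0

namespace YD

variable {n m : ℕ}

/-- The box `B(ε_i - δ_j)` (row `i` from the top, column `j` from the left)
belongs to the diagram `lam`. -/
def mem (lam : YD n m) (i j : ℕ) : Prop :=
  1 ≤ i ∧ i ≤ n ∧ 1 ≤ j ∧ j ≤ m ∧ j ≤ lam.part (n + 1 - i)

/-- The dual partition: `λ'_j = #{i ∈ {1,…,n} : λ_i ≥ j}`. -/
def dual (lam : YD n m) (j : ℕ) : ℕ :=
  ((Finset.Icc 1 n).filter (fun i => j ≤ lam.part i)).card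

/-- `mu` is obtained from `lam` by adding the box `B(ε_i - δ_j)`. -/
def IsAdd (lam : YD n m) (i j : ℕ) (mu : YD n m) : Prop :=
  ∀ i' j', mu.mem i' j' ↔ (lam.mem i' j' ∨ (i' = i ∧ j' = j))

/-- `mu` is obtained from `lam` by removing the box `B(ε_i - δ_j)`. -/
def IsRemove (lam : YD n m) (i j : ℕ) (mu : YD n m) : Prop :=
  ∀ i' j', mu.mem i' j' ↔ (lam.mem i' j' ∧ ¬(i' = i ∧ j' = j))

/-- `B(ε_i - δ_j)` is an outer corner of `lam`: it lies in the rectangle, is not a box of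
`lam`, and adding it to `lam` yields a Young diagram. -/
def OuterCorner (lam : YD n m) (i j : ℕ) : Prop :=
  1 ≤ i ∧ i ≤ n ∧ 1 ≤ j ∧ j ≤ m ∧ ¬ lam.mem i j ∧ ∃ mu : YD n m, lam.IsAdd i j mu

/-- `B(ε_i - δ_j)` is an inner corner of `lam`: it is a box of `lam` and removing it
from `lam` yields a Young diagram. -/
def InnerCorner (lam : YD n m) (i j : ℕ) : Prop :=
  lam.mem i j ∧ ∃ mu : YD n m, lam.IsRemove i j mu

/-- `λ^{-r} = (λ_2, …, λ_n, 0)`: delete the bottom (longest) row. -/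
def rowDel (lam : YD n m) : YD n m where
  part := fun i => if i = 0 then 0 else lam.part (i + 1)
  mono := by
    intro i j hi hij
    have hi' : i ≠ 0 := by omega
    have hj' : j ≠ 0 := by omega
    simp only [hi', hj', if_neg, ite_false]
    exact lam.mono (by omega) (by omega)
  le_m := by
    simpa using le_trans (lam.mono (by omega) (by omega : (1:ℕ) ≤ 2)) lam.le_m
  outside := by
    intro i hi
    have : i ≠ 0 := by omega
    simp only [this, ite_false]
    exact lam.outside _ (by omega)
  at_zero := by simp

/-- `λ^{+r} = (m, λ_1, …, λ_{n-1})`: add a full row of length `m` at the bottom. -/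
def rowAdd (lam : YD n m) : YD n m where
  part := fun i => if i = 0 ∨ n < i then 0 else if i = 1 then m else lam.part (i - 1)
  mono := by
    intro i j hi hij
    by_cases hj : j = 0 ∨ n < j
    · simp [hj]
    · have hi0 : ¬ (i = 0 ∨ n < i) := by omega
      simp only [hj, hi0, ite_false]
      by_cases hi1 : i = 1
      · subst hi1
        by_cases hj1 : j = 1
        · simp [hj1]
        · simp only [hj1, ite_false]
          exact le_trans (lam.mono (by omega) (by omega : 1 ≤ j - 1)) lam.le_m
      · have hj1 : j ≠ 1 := by omega
        simp only [hi1, hj1, ite_false]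
        exact lam.mono (by omega) (by omega)
  le_m := by
    by_cases hn : n = 0
    · simp [hn]
    · have : ¬ ((1:ℕ) = 0 ∨ n < 1) := by omega
      simp [this, hn]
  outside := by
    intro i hi
    simp [Or.inr hi]
  at_zero := by simp

/-- `λ^{-c} = (λ_1 - 1, …, λ_n - 1)`: delete the first column. -/
def colDel (lam : YD n m) : YD n m where
  part := fun i => lam.part i - 1
  mono := fun _ _ hi hij => Nat.sub_le_sub_right (lam.mono hi hij) 1
  le_m := le_trans (Nat.sub_le _ _) lam.le_m
  outside := fun i hi => by simp [lam.outside i hi]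
  at_zero := by simp [lam.at_zero]

/-- `λ^{+c} = (λ_1 + 1, …, λ_n + 1)`: add a full column of height `n` on the left.
(When `λ_1 = m` this clamps at `m`; the operation is only ever used when `λ_1 < m`,
where the clamping is vacuous.) -/
def colAdd (lam : YD n m) : YD n m where
  part := fun i => if i = 0 ∨ n < i then 0 else min m (lam.part i + 1)
  mono := by
    intro i j hi hij
    by_cases hj : j = 0 ∨ n < j
    · simp [hj]
    · have hi0 : ¬ (i = 0 ∨ n < i) := by omega
      simp only [hj, hi0, ite_false]
      exact min_le_min le_rfl (by exact Nat.succ_le_succ (lam.mono (by omega) hij))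
  le_m := by
    by_cases hn : n = 0
    · simp [hn]
    · have : ¬ ((1:ℕ) = 0 ∨ n < 1) := by omega
      simp [this, hn]
  outside := by intro i hi; simp [Or.inr hi]
  at_zero := by simp

end YD

/-- The generating relation for `∼` on `X × ℤ`:
`(λ, k) ∼ (λ^{-r}, k + m)` whenever `λ_1 = m`, and `(λ, k) ∼ (λ^{-c}, k + n)` whenever
`λ_n ≥ 1`. -/
inductive XRel (n m : ℕ) : YD n m × ℤ → YD n m × ℤ → Prop
  | row (lam : YD n m) (k : ℤ) (h : lam.part 1 = m) :
      XRel n m (lam, k) (lam.rowDel, k + m)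
  | col (lam : YD n m) (k : ℤ) (h : 1 ≤ lam.part n) :
      XRel n m (lam, k) (lam.colDel, k + n)

/-- The generating relation for `≈` on `X × ℤ` (only the row rule):
`(λ, k) ≈ (λ^{-r}, k + m)` whenever `λ_1 = m`. -/
inductive XRelRow (n m : ℕ) : YD n m × ℤ → YD n m × ℤ → Prop
  | row (lam : YD n m) (k : ℤ) (h : lam.part 1 = m) :
      XRelRow n m (lam, k) (lam.rowDel, k + m)

namespace YD

variable {n m : ℕ}

theorem ext_part {lam mu : YD n m} (h : ∀ i, 1 ≤ i → i ≤ n → lam.part i = mu.part i) :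
    lam = mu := by
  have hp : lam.part = mu.part := by
    funext i
    rcases Nat.eq_zero_or_pos i with rfl | hi
    · rw [lam.at_zero, mu.at_zero]
    · by_cases hin : i ≤ n
      · exact h i hi hin
      · rw [lam.outside i (by omega), mu.outside i (by omega)]
  cases lam
  cases mu
  cases hp
  rfl

/-- The quasi-periodic extension of `λ` to `ℤ`, reindexed to start at `0`:
`periodic (i + n) = periodic i - m` and `periodic i = λ_{i+1}` for `0 ≤ i < n`. -/
def periodic (lam : YD n m) (i : ℤ) : ℤ :=
  lam.part ((i % n).toNat + 1) - m * (i / n)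

theorem periodic_mul_add (lam : YD n m) (q : ℤ) {a : ℕ} (ha : a < n) :
    lam.periodic (n * q + a) = lam.part (a + 1) - m * q := by
  have hn : (n : ℤ) ≠ 0 := by omega
  have hmod : (n * q + a : ℤ) % n = a := by
    rw [Int.mul_add_emod_self_left, Int.emod_eq_of_lt (by omega) (by omega)]
  have hdiv : (n * q + a : ℤ) / n = q := by
    rw [Int.mul_add_ediv_left _ _ hn, Int.ediv_eq_zero_of_lt (by omega) (by omega), add_zero]
  simp [periodic, hmod, hdiv]

theorem exists_eq_mul_add (hn : 0 < n) (i : ℤ) : ∃ (q : ℤ) (a : ℕ), a < n ∧ i = n * q + a := by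
  have h0 : 0 ≤ i % n := Int.emod_nonneg _ (by omega)
  have h1 : i % n < n := Int.emod_lt_of_pos _ (by omega)
  refine ⟨i / n, (i % n).toNat, by omega, ?_⟩
  rw [Int.toNat_of_nonneg h0, Int.mul_ediv_add_emod]

theorem periodic_of_lt (lam : YD n m) {a : ℕ} (ha : a < n) :
    lam.periodic a = lam.part (a + 1) := by
  simpa using lam.periodic_mul_add 0 ha

theorem periodic_add_period (hn : 0 < n) (lam : YD n m) (i : ℤ) :
    lam.periodic (i + n) = lam.periodic i - m := by
  obtain ⟨q, a, ha, rfl⟩ := exists_eq_mul_add hn i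
  rw [show (n * q + a + n : ℤ) = n * (q + 1) + a by ring, periodic_mul_add _ _ ha,
    periodic_mul_add _ _ ha]
  ring

theorem periodic_succ (hn : 0 < n) (lam : YD n m) (q : ℤ) {a : ℕ} (ha : a < n) :
    lam.periodic (n * q + a + 1) =
      if a + 1 < n then (lam.part (a + 2) : ℤ) - m * q else lam.part 1 - m * q - m := by
  split_ifs with h
  · simpa [add_assoc] using lam.periodic_mul_add q h
  · have : (n : ℤ) = a + 1 := by omega
    rw [show (n * q + a + 1 : ℤ) = n * (q + 1) + (0 : ℕ) by push_cast; linear_combination -this,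
      periodic_mul_add _ _ hn]
    ring

theorem periodic_antitone (hn : 0 < n) (lam : YD n m) : Antitone lam.periodic := by
  refine antitone_int_of_succ_le fun i => ?_
  obtain ⟨q, a, ha, rfl⟩ := exists_eq_mul_add hn i
  rw [periodic_succ hn _ _ ha, periodic_mul_add _ _ ha]
  have h1 := lam.mono (show 1 ≤ a + 1 by omega) (show a + 1 ≤ a + 2 by omega)
  have h2 := lam.le_m
  split_ifs <;> omega

theorem periodic_injective : Function.Injective (periodic : YD n m → ℤ → ℤ) := by
  intro lam mu h
  refine ext_part fun i hi hin => ?_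
  have := congrFun h (i - 1 : ℕ)
  rw [periodic_of_lt _ (by omega), periodic_of_lt _ (by omega), Nat.sub_add_cancel hi] at this
  exact_mod_cast this

theorem periodic_rowDel (hn : 0 < n) {lam : YD n m} (h : lam.part 1 = m) (i : ℤ) :
    lam.rowDel.periodic i = lam.periodic (i + 1) := by
  obtain ⟨q, a, ha, rfl⟩ := exists_eq_mul_add hn i
  rw [periodic_succ hn _ _ ha, periodic_mul_add _ _ ha]
  have hp : lam.rowDel.part (a + 1) = lam.part (a + 2) := by simp [rowDel]
  rw [hp]
  split_ifs with hlt
  · rfl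
  · rw [lam.outside (a + 2) (by omega), h]
    push_cast
    ring

theorem periodic_colAdd (hn : 0 < n) {lam : YD n m} (h : lam.part 1 ≠ m) (i : ℤ) :
    lam.colAdd.periodic i = lam.periodic i + 1 := by
  obtain ⟨q, a, ha, rfl⟩ := exists_eq_mul_add hn i
  rw [periodic_mul_add _ _ ha, periodic_mul_add _ _ ha]
  have h1 := lam.mono le_rfl (show 1 ≤ a + 1 by omega)
  have h2 := lam.le_m
  have hp : lam.colAdd.part (a + 1) = lam.part (a + 1) + 1 := by
    simp only [colAdd]
    rw [if_neg (by omega), min_eq_right (by omega)]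
  rw [hp]
  push_cast
  ring

theorem colAdd_colDel {lam : YD n m} (h : 1 ≤ lam.part n) : lam.colDel.colAdd = lam := by
  refine ext_part fun i hi hin => ?_
  have h1 := lam.mono hi hin
  have h2 := lam.mono le_rfl hi
  have h3 := lam.le_m
  simp only [colAdd, colDel]
  rw [if_neg (by omega)]
  omega

theorem colDel_colAdd {lam : YD n m} (h : lam.part 1 ≠ m) : lam.colAdd.colDel = lam := by
  refine ext_part fun i hi hin => ?_
  have h2 := lam.mono le_rfl hi
  have h3 := lam.le_m
  simp only [colAdd, colDel]
  rw [if_neg (by omega)]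
  omega

/-- Rotation of the boundary path by one step: delete a full row if there is one,
otherwise add a column. -/
def rotate (p : YD n m × ℤ) : YD n m × ℤ :=
  if p.1.part 1 = m then (p.1.rowDel, p.2 + m) else (p.1.colAdd, p.2 - n)

/-- The number of columns added in the first `j` rotations starting from `p`. -/
def colCount (p : YD n m × ℤ) : ℕ → ℕ
  | 0 => 0
  | j + 1 => colCount p j + if (rotate^[j] p).1.part 1 = m then 0 else 1

theorem colCount_le (p : YD n m × ℤ) (j : ℕ) : colCount p j ≤ j := by
  induction j with
  | zero => exact le_rfl
  | succ j ih =>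
    rw [colCount]
    split_ifs <;> omega

theorem exists_colCount_eq (p : YD n m × ℤ) (j : ℕ) :
    ∀ t ≤ colCount p j, ∃ i, colCount p i = t := by
  induction j with
  | zero => exact fun t ht => ⟨0, (Nat.le_zero.mp ht).symm⟩
  | succ j ih =>
    intro t ht
    by_cases h : t ≤ colCount p j
    · exact ih t h
    · refine ⟨j + 1, le_antisymm ?_ ht⟩
      rw [colCount]
      split_ifs <;> omega

theorem rotate_iterate_snd (p : YD n m × ℤ) (j : ℕ) :
    (rotate^[j] p).2 = p.2 + m * j - (n + m) * colCount p j := by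
  induction j with
  | zero => simp [colCount]
  | succ j ih =>
    rw [Function.iterate_succ_apply', rotate, colCount]
    split_ifs <;> simp only [ih] <;> push_cast <;> ring

theorem periodic_rotate_iterate (hn : 0 < n) (p : YD n m × ℤ) (j : ℕ) (i : ℤ) :
    (rotate^[j] p).1.periodic i = p.1.periodic (i + j - colCount p j) + colCount p j := by
  induction j generalizing i with
  | zero => simp [colCount]
  | succ j ih =>
    rw [Function.iterate_succ_apply', rotate, colCount]
    split_ifs with h
    · rw [periodic_rowDel hn h, ih]
      push_cast
      ring_nf
    · rw [periodic_colAdd hn h, ih]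
      push_cast
      ring_nf

theorem colCount_period (hn : 0 < n) (p : YD n m × ℤ) : colCount p (n + m) = m := by
  have key := periodic_rotate_iterate hn p (n + m)
  set c := colCount p (n + m)
  set mu := (rotate^[n + m] p).1
  have hanti := p.1.periodic_antitone hn
  have hfirst (nu : YD n m) : nu.periodic 0 = nu.part 1 := by
    simpa using nu.periodic_of_lt hn
  have hlast (nu : YD n m) : nu.periodic (n - 1) = nu.part n := by
    have := nu.periodic_of_lt (show n - 1 < n by omega)
    rwa [Nat.sub_add_cancel hn, Nat.cast_sub hn, Nat.cast_one] at this
  have hper := p.1.periodic_add_period hn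
  have hle := p.1.le_m
  rcases lt_trichotomy c m with h | h | h
  · have h1 := key (n - 1)
    have h2 := hanti (show (n : ℤ) + n ≤ n - 1 + (n + m : ℕ) - c by push_cast; omega)
    have h3 := hper 0
    have h4 := hper n
    rw [zero_add, hfirst] at h3
    rw [hlast] at h1
    omega
  · exact h
  · have h1 := key 0
    have h2 := hanti (show (0 : ℤ) + (n + m : ℕ) - c ≤ n - 1 by push_cast; omega)
    have h3 := mu.le_m
    rw [hlast] at h2
    rw [hfirst] at h1
    omega

theorem isPeriodicPt_rotate (hn : 0 < n) (p : YD n m × ℤ) :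
    Function.IsPeriodicPt rotate (n + m) p := by
  refine Prod.ext (periodic_injective (funext fun i => ?_)) ?_
  · rw [periodic_rotate_iterate hn, colCount_period hn,
      show (i + (n + m : ℕ) - m : ℤ) = i + n by push_cast; ring, periodic_add_period hn]
    ring
  · rw [rotate_iterate_snd, colCount_period hn]
    push_cast
    ring

theorem eqvGen_rotate (hn : 0 < n) (p : YD n m × ℤ) :
    Relation.EqvGen (XRel n m) p (rotate p) := by
  obtain ⟨lam, k⟩ := p
  rw [rotate]
  split_ifs with h
  · exact .rel _ _ (.row lam k h)
  · have hc : 1 ≤ lam.colAdd.part n := by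
      have := lam.le_m
      simp only [colAdd] at h ⊢
      rw [if_neg (by omega)]
      omega
    have := XRel.col lam.colAdd (k - n) hc
    rw [colDel_colAdd h, sub_add_cancel] at this
    exact .symm _ _ (.rel _ _ this)

theorem eqvGen_rotate_iterate (hn : 0 < n) (p : YD n m × ℤ) (j : ℕ) :
    Relation.EqvGen (XRel n m) p (rotate^[j] p) := by
  induction j with
  | zero => exact .refl _
  | succ j ih =>
    rw [Function.iterate_succ_apply']
    exact .trans _ _ _ ih (eqvGen_rotate hn _)

theorem eqvGen_row_of_colCount_eq_zero (p : YD n m × ℤ) (j : ℕ) (h : colCount p j = 0) :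
    Relation.EqvGen (XRelRow n m) p (rotate^[j] p) := by
  induction j with
  | zero => exact .refl _
  | succ j ih =>
    rw [colCount] at h
    have h1 : (rotate^[j] p).1.part 1 = m := by
      by_contra h1
      simp [h1] at h
    refine .trans _ _ _ (ih (by omega)) (.rel _ _ ?_)
    rw [Function.iterate_succ_apply', rotate, if_pos h1]
    exact .row _ _ h1

theorem exists_iterate_symm (hn : 0 < n) {p q : YD n m × ℤ} (h : ∃ j, q = rotate^[j] p) :
    ∃ j, p = rotate^[j] q := by
  obtain ⟨j, rfl⟩ := h
  refine ⟨(n + m) * j - j, ?_⟩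
  have hle : j ≤ (n + m) * j := Nat.le_mul_of_pos_left j (by omega)
  rw [← Function.iterate_add_apply, Nat.sub_add_cancel hle]
  exact ((isPeriodicPt_rotate hn p).mul_const j).symm

theorem exists_iterate_of_eqvGen (hn : 0 < n) {p q : YD n m × ℤ}
    (h : Relation.EqvGen (XRel n m) p q) : ∃ j, q = rotate^[j] p := by
  induction h with
  | rel p q h =>
    cases h with
    | row lam k h => exact ⟨1, by simp [rotate, h]⟩
    | col lam k h =>
      refine exists_iterate_symm hn ⟨1, ?_⟩
      have h1 := lam.mono le_rfl hn
      have h2 := lam.le_m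
      have h3 : lam.colDel.part 1 ≠ m := by
        simp only [colDel]
        omega
      simp [rotate, h3, colAdd_colDel h]
  | refl p => exact ⟨0, rfl⟩
  | symm p q _ ih => exact exists_iterate_symm hn ih
  | trans p q r _ _ ih₁ ih₂ =>
    obtain ⟨i, rfl⟩ := ih₁
    obtain ⟨j, rfl⟩ := ih₂
    exact ⟨j + i, (Function.iterate_add_apply _ _ _ _).symm⟩

theorem colCount_add (p : YD n m × ℤ) (i j : ℕ) :
    colCount p (i + j) = colCount p i + colCount (rotate^[i] p) j := by
  induction j with
  | zero => rfl
  | succ j ih =>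
    rw [← add_assoc, colCount, colCount, ih, add_comm i j, Function.iterate_add_apply, add_assoc]

theorem dvd_snd_iff_of_eqvGen_row {p q : YD n m × ℤ} (h : Relation.EqvGen (XRelRow n m) p q) :
    (m : ℤ) ∣ p.2 ↔ (m : ℤ) ∣ q.2 := by
  induction h with
  | rel p q h =>
    cases h
    simp
  | refl p => rfl
  | symm p q _ ih => exact ih.symm
  | trans p q r _ _ ih₁ ih₂ => exact ih₁.trans ih₂

theorem dvd_rotate_iterate_snd_iff (p : YD n m × ℤ) (j : ℕ) :
    (m : ℤ) ∣ (rotate^[j] p).2 ↔ (m : ℤ) ∣ p.2 - n * colCount p j := by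
  rw [rotate_iterate_snd, show p.2 + m * j - (n + m) * colCount p j =
    p.2 - n * colCount p j + m * (j - colCount p j) by ring]
  exact dvd_add_left (dvd_mul_right _ _)

theorem eqvGen_row_of_eqvGen (hn : 0 < n) (hco : Nat.Coprime n m) {p q : YD n m × ℤ}
    (hp : (m : ℤ) ∣ p.2) (hq : (m : ℤ) ∣ q.2) (h : Relation.EqvGen (XRel n m) p q) :
    Relation.EqvGen (XRelRow n m) p q := by
  obtain ⟨j, rfl⟩ := exists_iterate_of_eqvGen hn h
  have hper := isPeriodicPt_rotate hn p
  rw [← hper.iterate_mod_apply j] at hq ⊢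
  have hlt : j % (n + m) < n + m := Nat.mod_lt _ (by omega)
  set i := j % (n + m)
  have hadd := colCount_add p i (n + m - i)
  rw [Nat.add_sub_cancel' hlt.le, colCount_period hn] at hadd
  have hdvd : m ∣ colCount p i := by
    rw [dvd_rotate_iterate_snd_iff, dvd_sub_right hp] at hq
    exact hco.symm.dvd_of_dvd_mul_left (by exact_mod_cast hq)
  rcases Nat.eq_zero_or_pos (colCount p i) with h0 | hpos
  · exact eqvGen_row_of_colCount_eq_zero p i h0
  · have hle := Nat.le_of_dvd hpos hdvd
    have hback := eqvGen_row_of_colCount_eq_zero (rotate^[i] p) (n + m - i) (by omega)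
    rw [← Function.iterate_add_apply, Nat.sub_add_cancel hlt.le, hper] at hback
    exact .symm _ _ hback

theorem exists_dvd_snd_eqvGen (hn : 0 < n) (hm : 0 < m) (hco : Nat.Coprime n m)
    (p : YD n m × ℤ) :
    ∃ q : YD n m × ℤ, (m : ℤ) ∣ q.2 ∧ Relation.EqvGen (XRel n m) p q := by
  obtain ⟨t, htm, ht⟩ : ∃ t : ℕ, t ≤ m ∧ (m : ℤ) ∣ p.2 - n * t := by
    have hm' : (m : ℤ) ≠ 0 := by omega
    obtain ⟨u, v, huv⟩ := Nat.isCoprime_iff_coprime.mpr hco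
    have h0 := Int.emod_nonneg (p.2 * u) hm'
    have h1 := Int.emod_lt_of_pos (p.2 * u) (show (0 : ℤ) < m by omega)
    refine ⟨((p.2 * u) % m).toNat, by omega, ?_⟩
    rw [Int.toNat_of_nonneg h0]
    refine ⟨p.2 * v + n * (p.2 * u / m), ?_⟩
    linear_combination (-p.2) * huv - n * Int.mul_ediv_add_emod (p.2 * u) m
  obtain ⟨j, hj⟩ := exists_colCount_eq p (n + m) t (by rwa [colCount_period hn])
  refine ⟨rotate^[j] p, ?_, eqvGen_rotate_iterate hn p j⟩
  rwa [dvd_rotate_iterate_snd_iff, hj]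

end YD

/-- Theorem 3.16 of the paper. For coprime `m, n`, the set `X × mℤ`
is a union of `≈`-equivalence classes, and sending the `≈`-class of `(λ, mℓ)` to its
`∼`-class `[λ, mℓ]` is a well-defined bijection from the `≈`-classes contained in
`X × mℤ` onto the `∼`-classes of `X × ℤ`: the map is well defined (`≈` refines `∼`),
injective (`∼`-related elements of `X × mℤ` are `≈`-related), and surjective (every
`∼`-class meets `X × mℤ`). -/
theorem row_classes_biject_with_classes (n m : ℕ) (hn : 0 < n) (hm : 0 < m)
    (hco : Nat.Coprime n m) :
    (∀ p q : YD n m × ℤ, (m : ℤ) ∣ p.2 →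
      Relation.EqvGen (XRelRow n m) p q → (m : ℤ) ∣ q.2) ∧
    (∀ p q : YD n m × ℤ, (m : ℤ) ∣ p.2 →
      Relation.EqvGen (XRelRow n m) p q → Relation.EqvGen (XRel n m) p q) ∧
    (∀ p q : YD n m × ℤ, (m : ℤ) ∣ p.2 → (m : ℤ) ∣ q.2 →
      Relation.EqvGen (XRel n m) p q → Relation.EqvGen (XRelRow n m) p q) ∧
    (∀ p : YD n m × ℤ, ∃ q : YD n m × ℤ,
      (m : ℤ) ∣ q.2 ∧ Relation.EqvGen (XRel n m) p q) := by
  refine ⟨fun p q hp h => (YD.dvd_snd_iff_of_eqvGen_row h).mp hp, fun p q _ h => ?_,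
    fun p q hp hq h => YD.eqvGen_row_of_eqvGen hn hco hp hq h,
    YD.exists_dvd_snd_eqvGen hn hm hco⟩
  refine h.mono fun a b hab => ?_
  cases hab with
  | row lam k h => exact .row lam k h
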